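/- Let X be a nonempty mixing (topologically mixing) one-step shift of finite type over a finite alphabet. Then LPS(X) is either the singleton {1} or a cofinite subset of ℕ. -/

import Mathlib

/-- The shift map on the full shift `A^ℤ`: `(σ x) i = x (i+1)`. -/
def shiftMap {A : Type*} : (ℤ → A) → (ℤ → A) := fun x i => x (i + 1)

/-- A one-step shift of finite type: the set of bi-infinite sequences all of whose
adjacent pairs lie in a relation `R ⊆ A × A`. -/
def IsOneStepSFT {A : Type*} (X : Set (ℤ → A)) : Prop :=
  ∃ R : Set (A × A), X = {x | ∀ i : ℤ, (x i, x (i + 1)) ∈ R}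

/-- The least period set of the shift restricted to a subset `X` of the full shift. -/
def LPSset {A : Type*} (X : Set (ℤ → A)) : Set ℕ :=
  {n | 0 < n ∧ ∃ x ∈ X, shiftMap^[n] x = x ∧ ∀ k, 0 < k → k < n → shiftMap^[k] x ≠ x}

/-- `S` is a cofinite subset of `ℕ = {1, 2, 3, ...}`. -/
def CofinitePos (S : Set ℕ) : Prop :=
  S ⊆ {n : ℕ | 0 < n} ∧ ({n : ℕ | 0 < n} \ S).Finite

/-- Topological mixing of the shift restricted to a subset `X` of the full shift. -/
def MixingOn {A : Type*} [TopologicalSpace A] (X : Set (ℤ → A)) : Prop :=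
  ∀ U V : Set (ℤ → A), IsOpen U → IsOpen V → (U ∩ X).Nonempty → (V ∩ X).Nonempty →
    ∃ N : ℕ, ∀ n : ℕ, N ≤ n → ∃ x ∈ X, x ∈ U ∧ shiftMap^[n] x ∈ V

lemma shiftMap_iterate {A : Type*} (n : ℕ) (x : ℤ → A) (i : ℤ) :
    shiftMap^[n] x i = x (i + n) := by
  induction n generalizing i with
  | zero => simp
  | succ n ih =>
    rw [Function.iterate_succ_apply', shiftMap, ih]
    congr 1
    push_cast
    ring

lemma shiftMap_iterate_eq_self_iff {A : Type*} (n : ℕ) (x : ℤ → A) :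
    shiftMap^[n] x = x ↔ Function.Periodic x (n : ℤ) := by
  simp only [funext_iff, shiftMap_iterate, Function.Periodic]

namespace IsOneStepSFT

variable {A : Type*} {X : Set (ℤ → A)}

lemma translate (hX : IsOneStepSFT X) {x : ℤ → A} (hx : x ∈ X) (m : ℤ) :
    (fun i => x (i + m)) ∈ X := by
  obtain ⟨R, rfl⟩ := hX
  intro i
  simpa [add_right_comm] using hx (i + m)

/-- Two points of a one-step SFT may be spliced at a common symbol. -/
lemma splice (hX : IsOneStepSFT X) {x y : ℤ → A} (hx : x ∈ X) (hy : y ∈ X) {m : ℤ}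
    (h : x m = y 0) : (fun i => if i ≤ m then x i else y (i - m)) ∈ X := by
  obtain ⟨R, rfl⟩ := hX
  intro i
  rcases lt_trichotomy i m with him | rfl | him
  · simpa [him.le, Int.add_one_le_iff.2 him] using hx i
  · simpa [h] using hy 0
  · have h2 : ¬ i + 1 ≤ m := by omega
    simpa [him.not_ge, h2, sub_add_eq_add_sub] using hy (i - m)

/-- A segment of a point of a one-step SFT with equal end symbols extends periodically. -/
lemma periodize (hX : IsOneStepSFT X) {x : ℤ → A} (hx : x ∈ X) {n : ℤ} (hn : 0 < n)
    (h : x n = x 0) : (fun i => x (i % n)) ∈ X := by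
  obtain ⟨R, rfl⟩ := hX
  intro i
  have h0 := Int.emod_nonneg i hn.ne'
  have h1 := Int.emod_lt_of_pos i hn
  have h2 := hx (i % n)
  have h3 : (i + 1) % n = (i % n + 1) % n := by simp
  rcases (Int.add_one_le_iff.2 h1).lt_or_eq with h4 | h4
  · rw [Int.emod_eq_of_lt (by omega) h4] at h3
    simpa [h3] using h2
  · rw [h4, Int.emod_self] at h3
    rw [h4, h] at h2
    simpa [h3] using h2

end IsOneStepSFT

lemma MixingOn.exists_connecting {A : Type*} [TopologicalSpace A] [DiscreteTopology A]
    {X : Set (ℤ → A)} (hmix : MixingOn X) {x y : ℤ → A} (hx : x ∈ X) (hy : y ∈ X) :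
    ∃ N : ℕ, ∀ n : ℕ, N ≤ n → ∃ z ∈ X, z 0 = x 0 ∧ z n = y 0 := by
  have hopen (a : A) : IsOpen {z : ℤ → A | z 0 = a} := by
    have hcont : Continuous fun z : ℤ → A => z 0 := continuous_apply 0
    exact (isOpen_discrete {a}).preimage hcont
  obtain ⟨N, hN⟩ := hmix _ _ (hopen (x 0)) (hopen (y 0)) ⟨x, rfl, hx⟩ ⟨y, rfl, hy⟩
  refine ⟨N, fun n hn => ?_⟩
  obtain ⟨z, hz, h1, h2⟩ := hN n hn
  refine ⟨z, hz, h1, ?_⟩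
  simpa [shiftMap_iterate] using h2

/-- A function which is `l`-periodic on a long initial segment, but not globally, has no
short period. -/
lemma not_periodic_of_initial_segment {A : Type*} {x : ℤ → A} {l M e : ℤ} (he : 0 < e)
    (heM : e + l ≤ M) (hx : ∀ j, 0 ≤ j → j + l ≤ M → x (j + l) = x j)
    (hl : ¬ Function.Periodic x l) : ¬ Function.Periodic x e := by
  intro hp
  refine hl fun i => ?_
  have h0 := Int.emod_nonneg i he.ne'
  have h1 := Int.emod_lt_of_pos i he
  have hi : i % e + (i / e) * e = i := by rw [mul_comm]; exact Int.emod_add_mul_ediv i e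
  have hper (j : ℤ) : x (j + (i / e) * e) = x j := by simpa using hp.int_mul (i / e) j
  calc x (i + l) = x (i % e + l + (i / e) * e) := by congr 1; linarith
    _ = x (i % e) := by rw [hper, hx _ h0 (by omega)]
    _ = x i := by rw [← hper, hi]

lemma mem_LPSset_of_connecting {A : Type*} {X : Set (ℤ → A)} (hX : IsOneStepSFT X)
    {a b : A} (hab : a ≠ b) {l : ℕ} (hl : 0 < l)
    (haa : ∃ z ∈ X, z 0 = a ∧ z l = a) (hab' : ∃ z ∈ X, z 0 = a ∧ z l = b)
    (hba : ∀ q : ℕ, l ≤ q → ∃ z ∈ X, z 0 = b ∧ z q = a) {n : ℕ} (hn : 8 * l ≤ n) :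
    n ∈ LPSset X := by
  obtain ⟨u, hu, hu0, hul⟩ := haa
  obtain ⟨f, hf, hf0, hfl⟩ := hab'
  obtain ⟨h, hh, hh0, hhq⟩ := hba (l + n % l) (by omega)
  have hl' : (0 : ℤ) < l := by exact_mod_cast hl
  have hr : n % l < l := Nat.mod_lt _ hl
  -- `M` is the length of the initial power of the loop at `a`
  obtain ⟨k, M, hM, hMn⟩ : ∃ k M : ℤ, M = k * l ∧ (n : ℤ) = M + l + (l + n % l : ℕ) := by
    refine ⟨n / l - 2, _, rfl, ?_⟩
    have := Int.emod_add_mul_ediv n l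
    push_cast
    linarith
  have hMl : (M + l) % l = 0 := by simp [hM]
  have hM0 : M % l = 0 := by simp [hM]
  have hu' := hX.periodize hu hl' (hul.trans hu0.symm)
  have hg₁ := hX.splice hu' hf (m := M) (by simp [hM0, hu0, hf0])
  have hg := hX.splice hg₁ hh (m := M + l) (by simp [hl.ne', hfl, hh0])
  set g : ℤ → A := _
  change g ∈ X at hg
  have hgu (j : ℤ) (hj : j ≤ M) : g j = u (j % l) := by
    simp [g, hj, show j ≤ M + l by omega]
  have hgl : g (M + l) = b := by simp [g, hl.ne', hfl]
  have hg0 : g 0 = a := by rw [hgu 0 (by omega)]; simpa using hu0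
  have hgn : g n = a := by
    have h1 : ¬ (n : ℤ) ≤ M + l := by omega
    have h2 : (n : ℤ) - (M + l) = (l + n % l : ℕ) := by omega
    simp only [g, h1, if_false, h2, hhq]
  have hn0 : (0 : ℤ) < n := by omega
  have hx := hX.periodize hg hn0 (hgn.trans hg0.symm)
  set x : ℤ → A := fun i => g (i % n)
  have hxg (j : ℤ) (h0 : 0 ≤ j) (h1 : j < n) : x j = g j := by
    simp only [x, Int.emod_eq_of_lt h0 h1]
  have hxn : Function.Periodic x (n : ℤ) := fun i => by simp [x]
  have hxl : ¬ Function.Periodic x (l : ℤ) := by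
    intro hp
    have h1 : x ((k + 1) * l) = x 0 := by simpa using hp.int_mul (k + 1) 0
    rw [show (k + 1) * (l : ℤ) = M + l by rw [hM]; ring, hxg _ (by omega) (by omega),
      hxg 0 le_rfl hn0, hgl, hg0] at h1
    exact hab h1.symm
  have hshort (e : ℤ) (he : 0 < e) (hen : 2 * e ≤ n) : ¬ Function.Periodic x e := by
    refine not_periodic_of_initial_segment (M := M) he (by omega) (fun j h0 h1 => ?_) hxl
    rw [hxg _ (by omega) (by omega), hxg _ (by omega) (by omega), hgu _ h1,
      hgu _ (by omega), Int.add_emod_right]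
  refine ⟨by omega, x, hx, (shiftMap_iterate_eq_self_iff n x).2 hxn, fun d hd hdn => ?_⟩
  rw [Ne, shiftMap_iterate_eq_self_iff]
  intro hp
  by_cases h2 : 2 * d ≤ n
  · exact hshort d (by omega) (by omega) hp
  · refine hshort (n - d) (by omega) (by omega) fun i => ?_
    rw [← hp, show i + ((n : ℤ) - d) + d = i + n by ring, hxn]

/-- The least period set of a nonempty mixing one-step SFT is either `{1}` or a cofinite
subset of `ℕ = {1, 2, ...}`. -/
theorem LPS_of_mixing_SFT {A : Type*} [Fintype A] [TopologicalSpace A]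
    [DiscreteTopology A] (X : Set (ℤ → A)) (hSFT : IsOneStepSFT X) (hne : X.Nonempty)
    (hmix : MixingOn X) :
    LPSset X = {1} ∨ CofinitePos (LPSset X) := by
  by_cases hex : ∃ x ∈ X, ∃ y ∈ X, x 0 ≠ y 0
  · right
    refine ⟨fun n hn => hn.1, ?_⟩
    obtain ⟨x, hx, y, hy, hxy⟩ := hex
    obtain ⟨N₁, h₁⟩ := hmix.exists_connecting hx hx
    obtain ⟨N₂, h₂⟩ := hmix.exists_connecting hx hy
    obtain ⟨N₃, h₃⟩ := hmix.exists_connecting hy hx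
    refine (Set.finite_lt_nat (8 * (N₁ + N₂ + N₃ + 1))).subset fun n hn => ?_
    by_contra hlt
    exact hn.2 (mem_LPSset_of_connecting hSFT hxy (Nat.succ_pos _) (h₁ _ (by omega))
      (h₂ _ (by omega)) (fun q hq => h₃ q (by omega)) (not_lt.1 hlt))
  · left
    push Not at hex
    have hfix (x) (hx : x ∈ X) : shiftMap x = x := by
      funext i
      simpa [shiftMap, add_comm] using
        hex _ (hSFT.translate hx (i + 1)) _ (hSFT.translate hx i)
    ext n
    constructor
    · rintro ⟨hn, x, hx, -, hmin⟩
      by_contra h1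
      exact hmin 1 one_pos (lt_of_le_of_ne hn (Ne.symm h1)) (hfix x hx)
    · rintro rfl
      obtain ⟨x, hx⟩ := hne
      exact ⟨one_pos, x, hx, hfix x hx, fun k h0 h1 => absurd h1 (by omega)⟩
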